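/- Suppose the positive random radius R satisfies P(R > u) = (1+o(1)) K u^{N} exp(−r u^{θ}) as u → ∞, for constants K > 0, r > 0, θ > 0, N ∈ ℝ (Kotz Type III). Set λ := α_ρ^{θ} with α_ρ := √(2/(1+ρ)). Then as u → ∞, S̃_u(1,1) = (1+o(1)) · [α_ρ^{N−θ+2} (1−ρ²)^{3/2} r^{(λ−1)N/θ} / (K (1−ρ)²)] · (K²/(2πθ))^{1−λ/2} · (ln u)^{(1−λ)N/θ + λ/2 − 1} · u^{−λ}. -/

import Mathlib

open MeasureTheory ProbabilityTheory Filter Real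

/-- The uniform distribution on the unit circle of `ℝ²`, obtained as the pushforward of the
normalized Lebesgue measure on `(0, 2π]` under the parametrization `θ ↦ (cos θ, sin θ)`. -/
noncomputable def uniformCircle : Measure (ℝ × ℝ) :=
  Measure.map (fun θ : ℝ => (Real.cos θ, Real.sin θ))
    ((ENNReal.ofReal (2 * Real.pi))⁻¹ • volume.restrict (Set.Ioc 0 (2 * Real.pi)))

/-- The logarithmic growth of `1 / cos` dominates its second-order Taylor polynomial with
second derivative replaced by its lower bound `1`. -/
theorem tan_mul_sub_add_sq_le_log_cos_sub {a x : ℝ} (ha : 0 ≤ a) (hax : a ≤ x)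
    (hx : x < π / 2) :
    tan a * (x - a) + (x - a) ^ 2 / 2 ≤ log (cos a) - log (cos x) := by
  have hcos : ∀ y ∈ Set.Icc a x, 0 < cos y := fun y hy =>
    cos_pos_of_mem_Ioo ⟨by linarith [hy.1, pi_pos], by linarith [hy.2]⟩
  have hderiv : ∀ y ∈ Set.Icc a x,
      HasDerivAt (fun y => -log (cos y) - tan a * (y - a) - (y - a) ^ 2 / 2)
        (tan y - tan a - (y - a)) y := by
    intro y hy
    have h1 := ((hasDerivAt_cos y).log (hcos y hy).ne').neg
    have h2 := ((hasDerivAt_id y).sub_const a).const_mul (tan a)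
    have h3 := (((hasDerivAt_id y).sub_const a).pow 2).div_const 2
    refine ((h1.sub h2).sub h3).congr_deriv ?_
    simp [tan_eq_sin_div_cos, neg_div]
  have hmono := monotoneOn_of_deriv_nonneg (convex_Icc a x)
    (fun y hy => (hderiv y hy).continuousAt.continuousWithinAt)
    (fun y hy => (hderiv y (interior_subset hy)).differentiableAt.differentiableWithinAt)
    (by
      intro y hy
      have hy' := interior_subset hy
      rw [(hderiv y hy').deriv]
      have hca := hcos a ⟨le_rfl, hax⟩
      have hcy := hcos y hy'
      have hs : 0 ≤ sin y := sin_nonneg_of_nonneg_of_le_pi (by linarith [hy'.1])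
        (by linarith [hy'.2, pi_pos])
      have hsa : 0 ≤ sin a := sin_nonneg_of_nonneg_of_le_pi ha (by linarith [pi_pos])
      have hcd : 0 < cos (y - a) := cos_pos_of_mem_Ioo
        ⟨by linarith [hy'.1, pi_pos], by linarith [hy'.2]⟩
      have hd : tan y - tan a = sin (y - a) / (cos y * cos a) := by
        rw [tan_eq_sin_div_cos, tan_eq_sin_div_cos, sin_sub]; field_simp
      have hle : tan (y - a) ≤ tan y - tan a := by
        rw [hd, tan_eq_sin_div_cos]
        apply div_le_div_of_nonneg_left _ (by positivity)
        · rw [cos_sub]; nlinarith [mul_nonneg hs hsa]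
        · exact sin_nonneg_of_nonneg_of_le_pi (by linarith [hy'.1])
            (by linarith [hy'.2, pi_pos])
      have := le_tan (x := y - a) (by linarith [hy'.1]) (by linarith [hy'.2])
      linarith)
  have := hmono ⟨le_rfl, hax⟩ ⟨hax, le_rfl⟩ hax
  simp only [sub_self] at this
  linarith

theorem log_cos_sub_log_cos_nonneg {a x : ℝ} (ha : 0 ≤ a) (hax : a ≤ x) (hx : x < π / 2) :
    0 ≤ log (cos a) - log (cos x) := by
  have h1 : 0 < cos x := cos_pos_of_mem_Ioo ⟨by linarith [pi_pos], hx⟩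
  have h2 : cos x ≤ cos a := cos_le_cos_of_nonneg_of_le_pi ha (by linarith [pi_pos]) hax
  linarith [log_le_log h1 h2]

theorem tendsto_mul_exp_sub_one {ι : Type*} {l : Filter ι} {A ε : ι → ℝ} {m : ℝ} (t : ℝ)
    (hA : Tendsto A l atTop) (hm : Tendsto (fun i => A i * ε i) l (nhds m)) :
    Tendsto (fun i => A i * (exp (t * ε i) - 1)) l (nhds (t * m)) := by
  have hε : Tendsto ε l (nhds 0) := by
    have := hm.div_atTop hA
    refine this.congr' ?_
    filter_upwards [hA.eventually_gt_atTop 0] with i hi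
    field_simp
  have h1 : Tendsto (fun i => t * (A i * ε i)) l (nhds (t * m)) := hm.const_mul t
  have h2 : Tendsto (fun i => t * (A i * ε i) * exp (t * ε i)) l (nhds (t * m)) := by
    have := h1.mul ((hε.const_mul t).rexp)
    simpa using this
  refine tendsto_of_tendsto_of_tendsto_of_le_of_le' h1 h2 ?_ ?_
  · filter_upwards [hA.eventually_gt_atTop 0] with i hi
    nlinarith [add_one_le_exp (t * ε i)]
  · filter_upwards [hA.eventually_gt_atTop 0] with i hi
    have h3 : exp (t * ε i) - 1 ≤ t * ε i * exp (t * ε i) := by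
      have h4 := add_one_le_exp (-(t * ε i))
      have h5 : exp (-(t * ε i)) * exp (t * ε i) = 1 := by rw [← exp_add]; simp
      nlinarith [exp_pos (t * ε i)]
    calc A i * (exp (t * ε i) - 1) ≤ A i * (t * ε i * exp (t * ε i)) := by gcongr
      _ = _ := by ring

/-- The Kotz Type III tail function. -/
noncomputable def kotzTail (K r θ N x : ℝ) : ℝ := K * x ^ N * exp (-r * x ^ θ)

theorem kotzTail_pos {K x : ℝ} (hK : 0 < K) (hx : 0 < x) (r θ N : ℝ) :
    0 < kotzTail K r θ N x := by
  unfold kotzTail; positivity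

theorem kotzTail_mul_exp (K r θ N : ℝ) {x : ℝ} (hx : 0 < x) (ε : ℝ) :
    kotzTail K r θ N (x * exp ε) =
      kotzTail K r θ N x * exp (N * ε - r * (x ^ θ * (exp (θ * ε) - 1))) := by
  unfold kotzTail
  rw [mul_rpow hx.le (exp_pos _).le, mul_rpow hx.le (exp_pos _).le, ← exp_mul, ← exp_mul,
    mul_comm ε N, mul_comm ε θ]
  have : exp (N * ε - r * (x ^ θ * (exp (θ * ε) - 1))) * exp (-r * x ^ θ) =
      exp (N * ε) * exp (-r * (x ^ θ * exp (θ * ε))) := by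
    rw [← exp_add, ← exp_add]; ring_nf
  linear_combination (-K * x ^ N) * this

theorem div_cos_eq_mul_exp {a x b : ℝ} (ha : 0 < cos a) (hx : 0 < cos x) :
    b / cos x = b / cos a * exp (log (cos a) - log (cos x)) := by
  rw [exp_sub, exp_log ha, exp_log hx]; field_simp

/-- Laplace's method for `∫ G (b / cos φ)` near the left endpoint `a`, in the scale `τ`. -/
theorem tendsto_laplace_div_cos {G : ℝ → ℝ} (hGanti : Antitone G) (hG0 : ∀ x, 0 ≤ G x)
    {K r θ N : ℝ} (hK : 0 < K) (hr : 0 < r) (hθ : 0 < θ)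
    (hG : Tendsto (fun u => G u / kotzTail K r θ N u) atTop (nhds 1))
    {a : ℝ} (ha : 0 ≤ a) (ha' : a < π / 2) {τ m : ℝ → ℝ} (hτ : Tendsto τ atTop atTop)
    (hm : ∀ s > 0, Tendsto
      (fun b => (b / cos a) ^ θ * (log (cos a) - log (cos (a + s / τ b)))) atTop (nhds (m s)))
    (hbound : ∀ᶠ b in atTop, ∀ s > 0, a + s / τ b < π / 2 →
      m s ≤ (b / cos a) ^ θ * (log (cos a) - log (cos (a + s / τ b))))
    (hintg : IntegrableOn (fun s => exp (-(r * θ / 2) * m s)) (Set.Ioi 0)) :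
    Tendsto (fun b => τ b * (∫ φ in Set.Ioo a (π / 2), G (b / cos φ)) /
        kotzTail K r θ N (b / cos a)) atTop
      (nhds (∫ s in Set.Ioi 0, exp (-(r * θ) * m s))) := by
  have hca : 0 < cos a := cos_pos_of_mem_Ioo ⟨by linarith [pi_pos], ha'⟩
  have hx : Tendsto (fun b => b / cos a) atTop atTop := tendsto_id.atTop_div_const hca
  have hA : Tendsto (fun b => (b / cos a) ^ θ) atTop atTop := (tendsto_rpow_atTop hθ).comp hx
  set H : ℝ → ℝ → ℝ := fun b => (Set.Ioo a (π / 2)).indicator (fun φ => G (b / cos φ)) with hH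
  have hmeas : ∀ b, Measurable (H b) := fun b =>
    (hGanti.measurable.comp (measurable_const.div measurable_cos)).indicator measurableSet_Ioo
  have hcosx : ∀ {φ}, φ ∈ Set.Ioo a (π / 2) → 0 < cos φ := fun {φ} h =>
    cos_pos_of_mem_Ioo ⟨by linarith [pi_pos, h.1], h.2⟩
  have key : Tendsto (fun b => ∫ s, H b (a + s / τ b) / kotzTail K r θ N (b / cos a)) atTop
      (nhds (∫ s, (Set.Ioi 0).indicator (fun s => exp (-(r * θ) * m s)) s)) := by
    refine tendsto_integral_filter_of_dominated_convergence
      ((Set.Ioi 0).indicator (fun s => 2 * exp (-(r * θ / 2) * m s))) ?_ ?_ ?_ ?_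
    · refine Eventually.of_forall fun b => Measurable.aestronglyMeasurable ?_
      exact ((hmeas b).comp (by fun_prop)).div_const _
    · obtain ⟨B, hB⟩ := eventually_atTop.1
        ((hG.eventually_lt_const (one_lt_two)).and (eventually_gt_atTop 0))
      filter_upwards [hbound, hτ.eventually_gt_atTop 0, eventually_ge_atTop B,
        eventually_gt_atTop 0, hA.eventually_ge_atTop (2 * |N| / (r * θ))]
        with b hb hτb hbB hb0 hAN
      refine Eventually.of_forall fun s => ?_
      by_cases hs : a + s / τ b ∈ Set.Ioo a (π / 2)
      · have hs0 : 0 < s := by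
          have : 0 < s / τ b := by linarith [hs.1]
          exact (div_pos_iff_of_pos_right hτb).1 this
        have hms := hb s hs0 hs.2
        rw [hH]
        simp only [Set.indicator_of_mem hs, Set.indicator_of_mem (Set.mem_Ioi.2 hs0)]
        set φ := a + s / τ b
        have hcφ := hcosx hs
        have hfx := kotzTail_pos hK (div_pos hb0 hca) r θ N
        have hε := log_cos_sub_log_cos_nonneg ha hs.1.le hs.2
        have hyB : B ≤ b / cos φ := hbB.trans (le_div_self hb0.le hcφ (cos_le_one _))
        have hy := hB _ hyB
        have hfy := kotzTail_pos hK hy.2 r θ N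
        have h1 : G (b / cos φ) ≤ 2 * kotzTail K r θ N (b / cos φ) :=
          ((div_lt_iff₀ hfy).1 hy.1).le
        rw [norm_of_nonneg (div_nonneg (hG0 _) hfx.le), div_le_iff₀ hfx]
        refine h1.trans ?_
        rw [div_cos_eq_mul_exp hca hcφ, kotzTail_mul_exp _ _ _ _ (div_pos hb0 hca)]
        set ε := log (cos a) - log (cos φ)
        have hA0 : 0 < (b / cos a) ^ θ := by positivity
        have hN : N ≤ r * θ / 2 * (b / cos a) ^ θ := by
          rw [div_le_iff₀ (by positivity)] at hAN
          linarith [le_abs_self N]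
        have h2 : θ * ε ≤ exp (θ * ε) - 1 := by linarith [add_one_le_exp (θ * ε)]
        have h3 : N * ε - r * ((b / cos a) ^ θ * (exp (θ * ε) - 1)) ≤ -(r * θ / 2) * m s := by
          have h4 : r * ((b / cos a) ^ θ * (θ * ε)) ≤
              r * ((b / cos a) ^ θ * (exp (θ * ε) - 1)) := by gcongr
          have h5 : N * ε ≤ r * θ / 2 * (b / cos a) ^ θ * ε := by gcongr
          have h6 : r * θ / 2 * m s ≤ r * θ / 2 * ((b / cos a) ^ θ * ε) := by gcongr
          linarith
        have := exp_le_exp.2 h3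
        nlinarith
      · rw [hH]
        simp only [Set.indicator_of_notMem hs, zero_div, norm_zero]
        exact Set.indicator_nonneg (fun _ _ => by positivity) _
    · rw [integrable_indicator_iff measurableSet_Ioi]
      exact hintg.const_mul 2
    · refine Eventually.of_forall fun s => ?_
      by_cases hs : 0 < s
      · rw [Set.indicator_of_mem (Set.mem_Ioi.2 hs)]
        have hsτ : Tendsto (fun b => a + s / τ b) atTop (nhds a) := by
          simpa using (tendsto_const_nhds (x := a)).add
            ((tendsto_const_nhds (x := s)).div_atTop hτ)
        have hmem : ∀ᶠ b in atTop, a + s / τ b ∈ Set.Ioo a (π / 2) := by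
          filter_upwards [hsτ.eventually_lt_const ha', hτ.eventually_gt_atTop 0] with b h1 h2
          exact ⟨by have := div_pos hs h2; linarith, h1⟩
        have hεA := hm s hs
        have hε : Tendsto (fun b => log (cos a) - log (cos (a + s / τ b))) atTop (nhds 0) := by
          refine (hεA.div_atTop hA).congr' ?_
          filter_upwards [hA.eventually_gt_atTop 0] with i hi
          field_simp
        have hy : Tendsto (fun b => b / cos (a + s / τ b)) atTop atTop := by
          refine tendsto_atTop_mono' _ ?_ tendsto_id
          filter_upwards [hmem, eventually_ge_atTop 0] with b h1 h2
          exact le_div_self h2 (hcosx h1) (cos_le_one _)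
        have h1 := (hG.comp hy).mul
          (((hε.const_mul N).sub ((tendsto_mul_exp_sub_one θ hA hεA).const_mul r)).rexp)
        have h2 : 1 * exp (N * 0 - r * (θ * m s)) = exp (-(r * θ) * m s) := by ring_nf
        rw [h2] at h1
        refine h1.congr' ?_
        filter_upwards [hmem, eventually_gt_atTop 0] with b hb hb0
        rw [hH]
        simp only [Set.indicator_of_mem hb, Function.comp]
        have hfx := kotzTail_pos hK (div_pos hb0 hca) r θ N
        have hcφ := hcosx hb
        have hfy := kotzTail_pos hK (div_pos hb0 hcφ) r θ N
        have h3 := kotzTail_mul_exp K r θ N (div_pos hb0 hca)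
          (log (cos a) - log (cos (a + s / τ b)))
        rw [← div_cos_eq_mul_exp hca hcφ] at h3
        rw [div_mul_eq_mul_div, div_eq_div_iff hfy.ne' hfx.ne', h3]
        ring
      · rw [Set.indicator_of_notMem (by simpa using hs)]
        refine tendsto_const_nhds.congr' ?_
        filter_upwards [hτ.eventually_gt_atTop 0] with b hb
        simp only [hH]
        rw [Set.indicator_of_notMem, zero_div]
        intro h
        have : 0 < s / τ b := by linarith [h.1]
        exact hs ((div_pos_iff_of_pos_right hb).1 this)
  rw [integral_indicator measurableSet_Ioi] at key
  refine key.congr' ?_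
  filter_upwards [hτ.eventually_gt_atTop 0] with b hb
  rw [integral_div, Measure.integral_comp_div (fun x => H b (a + x)),
    integral_add_left_eq_self (H b), abs_of_pos hb, smul_eq_mul,
    integral_indicator measurableSet_Ioo]

theorem tendsto_laplace_zero {G : ℝ → ℝ} (hGanti : Antitone G) (hG0 : ∀ x, 0 ≤ G x)
    {K r θ N : ℝ} (hK : 0 < K) (hr : 0 < r) (hθ : 0 < θ)
    (hG : Tendsto (fun u => G u / kotzTail K r θ N u) atTop (nhds 1)) :
    Tendsto (fun b => b ^ (θ / 2) * (∫ φ in Set.Ioo 0 (π / 2), G (b / cos φ)) /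
        kotzTail K r θ N b) atTop (nhds (√(π / (r * θ / 2)) / 2)) := by
  have hτ : Tendsto (fun b : ℝ => b ^ (θ / 2)) atTop atTop := tendsto_rpow_atTop (by positivity)
  have hsq : ∀ b : ℝ, 0 < b → b ^ θ = b ^ (θ / 2) * b ^ (θ / 2) := fun b hb => by
    rw [← rpow_add hb]; ring_nf
  have hlower : ∀ b : ℝ, 0 < b → ∀ s > 0, 0 + s / b ^ (θ / 2) < π / 2 →
      s ^ 2 / 2 ≤ (b / cos 0) ^ θ * (log (cos 0) - log (cos (0 + s / b ^ (θ / 2)))) := by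
    intro b hb s hs h
    have hb' : 0 < b ^ (θ / 2) := by positivity
    have h1 := tan_mul_sub_add_sq_le_log_cos_sub le_rfl
      (show 0 ≤ 0 + s / b ^ (θ / 2) by positivity) h
    rw [tan_zero, zero_mul, zero_add, sub_zero] at h1
    have h2 := mul_le_mul_of_nonneg_left h1 (show 0 ≤ b ^ θ by positivity)
    rw [cos_zero, div_one] at *
    refine le_trans (le_of_eq ?_) h2
    rw [hsq b hb]
    field_simp
    simp
  have := tendsto_laplace_div_cos hGanti hG0 hK hr hθ hG le_rfl (by positivity) hτ
    (m := fun s => s ^ 2 / 2) ?_ ?_ ?_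
  · rw [← integral_gaussian_Ioi]
    simp only [cos_zero, div_one] at this
    convert this using 5
    ring_nf
  · intro s hs
    have hsτ : Tendsto (fun b : ℝ => 0 + s / b ^ (θ / 2)) atTop (nhds 0) := by
      simpa using (tendsto_const_nhds (x := s)).div_atTop hτ
    have hcos : Tendsto (fun b : ℝ => s ^ 2 / 2 / cos (0 + s / b ^ (θ / 2))) atTop
        (nhds (s ^ 2 / 2)) := by
      have h1 : Tendsto (fun b : ℝ => cos (0 + s / b ^ (θ / 2))) atTop (nhds 1) := by
        simpa [Function.comp_def] using (continuous_cos.tendsto 0).comp hsτ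
      simpa [Pi.div_def] using (tendsto_const_nhds (x := s ^ 2 / 2)).div h1 one_ne_zero
    refine tendsto_of_tendsto_of_tendsto_of_le_of_le' tendsto_const_nhds hcos ?_ ?_
    · filter_upwards [hsτ.eventually_lt_const (show 0 < π / 2 by positivity),
        eventually_gt_atTop 0] with b hb hb0
      exact hlower b hb0 s hs hb
    · filter_upwards [hsτ.eventually_lt_const (show 0 < π / 2 by positivity),
        eventually_gt_atTop 0] with b hb hb0
      have hb' : 0 < b ^ (θ / 2) := by positivity
      have hc : 0 < cos (0 + s / b ^ (θ / 2)) := cos_pos_of_mem_Ioo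
        ⟨by have : 0 < s / b ^ (θ / 2) := by positivity
            linarith [pi_pos], hb⟩
      have h1 := log_le_sub_one_of_pos (inv_pos.2 hc)
      rw [log_inv] at h1
      have h2 := one_sub_sq_div_two_le_cos (x := 0 + s / b ^ (θ / 2))
      have h3 : -log (cos (0 + s / b ^ (θ / 2))) ≤
          (0 + s / b ^ (θ / 2)) ^ 2 / 2 / cos (0 + s / b ^ (θ / 2)) := by
        refine h1.trans ?_
        rw [le_div_iff₀ hc, sub_mul, inv_mul_cancel₀ hc.ne']
        linarith
      rw [cos_zero, div_one, log_one, zero_sub]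
      refine (mul_le_mul_of_nonneg_left h3 (show 0 ≤ b ^ θ by positivity)).trans (le_of_eq ?_)
      rw [hsq b hb0]
      field_simp
      simp
  · filter_upwards [eventually_gt_atTop 0] with b hb using hlower b hb
  · have := (integrable_exp_neg_mul_sq (b := r * θ / 4) (by positivity)).integrableOn
      (s := Set.Ioi 0)
    refine this.congr_fun (fun s _ => ?_) measurableSet_Ioi
    ring_nf

theorem tendsto_laplace_pos {G : ℝ → ℝ} (hGanti : Antitone G) (hG0 : ∀ x, 0 ≤ G x)
    {K r θ N : ℝ} (hK : 0 < K) (hr : 0 < r) (hθ : 0 < θ)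
    (hG : Tendsto (fun u => G u / kotzTail K r θ N u) atTop (nhds 1))
    {a : ℝ} (ha : 0 < a) (ha' : a < π / 2) :
    Tendsto (fun b => (b / cos a) ^ θ * (∫ φ in Set.Ioo a (π / 2), G (b / cos φ)) /
        kotzTail K r θ N (b / cos a)) atTop (nhds (1 / (r * θ * tan a))) := by
  have hca : 0 < cos a := cos_pos_of_mem_Ioo ⟨by linarith [pi_pos], ha'⟩
  have hta : 0 < tan a := tan_pos_of_pos_of_lt_pi_div_two ha ha'
  have hτ : Tendsto (fun b : ℝ => (b / cos a) ^ θ) atTop atTop :=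
    (tendsto_rpow_atTop hθ).comp (tendsto_id.atTop_div_const hca)
  have hval : ∀ c : ℝ, 0 < c → ∫ s in Set.Ioi (0 : ℝ), exp (-c * (tan a * s)) =
      1 / (c * tan a) := by
    intro c hc
    have h := integral_exp_mul_Ioi (a := -(c * tan a)) (neg_lt_zero.2 (by positivity)) 0
    simp only [mul_zero, exp_zero, neg_div_neg_eq] at h
    rw [← h]
    congr! 3
    ring
  have := tendsto_laplace_div_cos hGanti hG0 hK hr hθ hG ha.le ha' hτ
    (m := fun s => tan a * s) ?_ ?_ ?_
  · rwa [hval _ (by positivity)] at this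
  · intro s hs
    have hd : HasDerivAt (fun t => log (cos a) - log (cos (a + t * s))) (tan a * s) 0 := by
      have h1 : HasDerivAt (fun t => a + t * s) s 0 := by
        simpa using ((hasDerivAt_id (0 : ℝ)).mul_const s).const_add a
      have h2 := (h1.cos.log (by simpa using hca.ne')).const_sub (log (cos a))
      refine h2.congr_deriv ?_
      simp [tan_eq_sin_div_cos]
      ring
    have h1 := hd.tendsto_slope_zero_right.comp
      (tendsto_inv_atTop_nhdsGT_zero.comp hτ)
    refine h1.congr fun b => ?_
    simp [Function.comp_def, div_eq_mul_inv, mul_comm]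
  · filter_upwards [eventually_gt_atTop 0] with b hb s hs h
    have hb' : 0 < (b / cos a) ^ θ := by positivity
    have h0 : 0 < s / (b / cos a) ^ θ := by positivity
    have h1 := tan_mul_sub_add_sq_le_log_cos_sub ha.le
      (show a ≤ a + s / (b / cos a) ^ θ by linarith) h
    have h2 := mul_le_mul_of_nonneg_left h1 hb'.le
    refine le_trans ?_ h2
    rw [add_sub_cancel_left, mul_add]
    have h3 : (b / cos a) ^ θ * (tan a * (s / (b / cos a) ^ θ)) = tan a * s := by
      field_simp
    rw [h3]
    have : 0 ≤ (b / cos a) ^ θ * ((s / (b / cos a) ^ θ) ^ 2 / 2) := by positivity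
    linarith
  · have := exp_neg_integrableOn_Ioi 0 (show 0 < r * θ / 2 * tan a by positivity)
    refine this.congr_fun (fun s _ => ?_) measurableSet_Ioi
    ring_nf

instance isFiniteMeasure_uniformCircle : IsFiniteMeasure uniformCircle := by
  unfold uniformCircle
  have : IsFiniteMeasure ((ENNReal.ofReal (2 * Real.pi))⁻¹ •
      (volume : Measure ℝ).restrict (Set.Ioc 0 (2 * Real.pi))) :=
    Measure.smul_finite _ (by simp [pi_pos])
  infer_instance

theorem countable_setOf_cos_eq (c : ℝ) : {t : ℝ | cos t = c}.Countable := by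
  rcases Set.eq_empty_or_nonempty {t : ℝ | cos t = c} with h | ⟨t₀, ht₀⟩
  · simp [h]
  · refine ((Set.countable_range fun k : ℤ => 2 * (k : ℝ) * π + t₀).union
      (Set.countable_range fun k : ℤ => 2 * (k : ℝ) * π - t₀)).mono fun t ht => ?_
    obtain ⟨k, hk | hk⟩ := cos_eq_cos_iff.1 ((show cos t₀ = c from ht₀).trans
      (show cos t = c from ht).symm)
    · exact Or.inl ⟨k, hk.symm⟩
    · exact Or.inr ⟨k, hk.symm⟩

theorem uniformCircle_setOf_fst_eq (c : ℝ) : uniformCircle {y | y.1 = c} = 0 := by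
  unfold uniformCircle
  rw [Measure.map_apply (by fun_prop) (measurableSet_eq_fun (by fun_prop) (by fun_prop)),
    Measure.smul_apply, Measure.restrict_apply' measurableSet_Ioc]
  have : volume ((fun t : ℝ => (cos t, sin t)) ⁻¹' {y | y.1 = c} ∩ Set.Ioc 0 (2 * π)) = 0 :=
    ((countable_setOf_cos_eq c).mono fun t ht => ht.1).measure_zero _
  rw [this, smul_zero]

theorem prod_uniformCircle_setOf_mul_eq {ν : Measure ℝ} [IsProbabilityMeasure ν]
    (hν : ν (Set.Iic 0) = 0) (b : ℝ) :
    (ν.prod uniformCircle) {p | p.1 * p.2.1 = b} = 0 := by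
  rw [Measure.prod_apply (measurableSet_eq_fun (by fun_prop) (by fun_prop))]
  refine (lintegral_congr_ae ?_).trans lintegral_zero
  have : ∀ᵐ r ∂ν, r ∉ Set.Iic 0 := measure_eq_zero_iff_ae_notMem.1 hν
  filter_upwards [this] with r hr
  have hr0 : 0 < r := by simpa using hr
  refine measure_mono_null (fun y hy => ?_) (uniformCircle_setOf_fst_eq (b / r))
  have h : r * y.1 = b := hy
  change y.1 = b / r
  rw [← h]
  field_simp

/-- Mass of the radii for which both linear forms of an elliptical vector in direction `t`
exceed `b`. -/
noncomputable def radialMass (ν : Measure ℝ) (ψ b t : ℝ) : ℝ :=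
  (ν {r | b < r * cos t ∧ b < r * cos (t - ψ)}).toReal

theorem measurable_radialMass (ν : Measure ℝ) [IsProbabilityMeasure ν] (ψ b : ℝ) :
    Measurable (radialMass ν ψ b) := by
  have hs : MeasurableSet {p : ℝ × ℝ | b < p.1 * cos p.2 ∧ b < p.1 * cos (p.2 - ψ)} := by
    rw [Set.ofPred_and]
    exact (measurableSet_lt (by fun_prop) (by fun_prop)).inter
      (measurableSet_lt (by fun_prop) (by fun_prop))
  exact (measurable_measure_prodMk_right (μ := ν) hs).ennreal_toReal

theorem radialMass_eq_of_cos_pos {ν : Measure ℝ} (hν : ν (Set.Iic 0) = 0)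
    {ψ b t : ℝ} (hle : cos t ≤ cos (t - ψ)) (hpos : 0 < cos t) :
    radialMass ν ψ b t = (ν (Set.Ioi (b / cos t))).toReal := by
  unfold radialMass
  congr 1
  refine measure_congr ?_
  have : ∀ᵐ r ∂ν, r ∉ Set.Iic 0 := measure_eq_zero_iff_ae_notMem.1 hν
  filter_upwards [this] with r hr
  have hr0 : 0 < r := by simpa using hr
  apply propext
  change (b < r * cos t ∧ b < r * cos (t - ψ)) ↔ b / cos t < r
  rw [div_lt_iff₀ hpos]
  exact ⟨fun h => h.1, fun h => ⟨h, h.trans_le (by gcongr)⟩⟩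

theorem radialMass_eq_zero {ν : Measure ℝ} (hν : ν (Set.Iic 0) = 0)
    {ψ b t : ℝ} (hb : 0 < b) (hnonpos : cos t ≤ 0) :
    radialMass ν ψ b t = 0 := by
  unfold radialMass
  rw [measure_mono_null (fun r hr => ?_) hν, ENNReal.toReal_zero]
  by_contra h
  have hr0 : 0 < r := by simpa using h
  have h1 : b < r * cos t := hr.1
  nlinarith

theorem periodic_radialMass (ν : Measure ℝ) (ψ b : ℝ) :
    Function.Periodic (radialMass ν ψ b) (2 * π) := by
  intro t
  unfold radialMass
  rw [cos_add_two_pi, show t + 2 * π - ψ = t - ψ + 2 * π by ring, cos_add_two_pi]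

theorem radialMass_half_sub (ν : Measure ℝ) (ψ b t : ℝ) :
    radialMass ν ψ b (ψ / 2 - t) = radialMass ν ψ b (ψ / 2 + t) := by
  unfold radialMass
  rw [show ψ / 2 - t - ψ = -(ψ / 2 + t) by ring, show ψ / 2 + t - ψ = -(ψ / 2 - t) by ring,
    cos_neg, cos_neg]
  simp only [and_comm]

theorem integral_radialMass {ν : Measure ℝ} [IsProbabilityMeasure ν] (hν : ν (Set.Iic 0) = 0)
    {ψ b : ℝ} (hψ : 0 ≤ ψ) (hψ' : ψ < π) (hb : 0 < b) :
    ∫ t in (0)..(2 * π), radialMass ν ψ b t =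
      2 * ∫ φ in Set.Ioo (ψ / 2) (π / 2), (ν (Set.Ioi (b / cos φ))).toReal := by
  have hintg : ∀ c d : ℝ, IntervalIntegrable (fun t => radialMass ν ψ b (ψ / 2 + t)) volume c d := by
    intro c d
    refine (intervalIntegrable_const (c := (1 : ℝ))).mono_fun
      ((measurable_radialMass ν ψ b).comp (by fun_prop)).aestronglyMeasurable
      (Eventually.of_forall fun t => ?_)
    simp only [norm_one]
    rw [norm_of_nonneg (show 0 ≤ radialMass ν ψ b (ψ / 2 + t) from ENNReal.toReal_nonneg)]
    exact measureReal_le_one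
  have h1 := (periodic_radialMass ν ψ b).intervalIntegral_add_eq 0 (ψ / 2 - π)
  rw [zero_add] at h1
  rw [h1, show ψ / 2 - π = ψ / 2 + -π by ring, show ψ / 2 + -π + 2 * π = ψ / 2 + π by ring,
    ← intervalIntegral.integral_comp_add_left (fun x => radialMass ν ψ b x),
    ← intervalIntegral.integral_add_adjacent_intervals (hintg (-π) 0) (hintg 0 π)]
  have h2 : ∫ t in (-π)..0, radialMass ν ψ b (ψ / 2 + t) =
      ∫ t in (0)..π, radialMass ν ψ b (ψ / 2 + t) := by
    have := intervalIntegral.integral_comp_neg (a := 0) (b := π)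
      (fun t => radialMass ν ψ b (ψ / 2 + t))
    rw [neg_zero] at this
    rw [← this]
    refine intervalIntegral.integral_congr fun t _ => ?_
    rw [← radialMass_half_sub]
    ring_nf
  rw [h2, ← two_mul, intervalIntegral.integral_comp_add_left (fun x => radialMass ν ψ b x),
    add_zero, intervalIntegral.integral_of_le (by linarith [pi_pos])]
  congr 1
  rw [setIntegral_eq_of_subset_of_forall_sdiff_eq_zero (s := Set.Ioo (ψ / 2) (π / 2))
    measurableSet_Ioc]
  · refine setIntegral_congr_fun measurableSet_Ioo fun t ht => ?_
    refine radialMass_eq_of_cos_pos hν ?_ (cos_pos_of_mem_Ioo ⟨by linarith [ht.1, pi_pos], ht.2⟩)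
    rw [← cos_abs (t - ψ)]
    refine cos_le_cos_of_nonneg_of_le_pi (abs_nonneg _) (by linarith [ht.2, pi_pos]) ?_
    exact abs_le.2 ⟨by linarith [ht.1], by linarith⟩
  · intro t ht
    exact ⟨ht.1, by linarith [ht.2, pi_pos]⟩
  · intro t ht
    have h3 : π / 2 ≤ t := by
      by_contra h
      exact ht.2 ⟨ht.1.1, not_le.1 h⟩
    exact radialMass_eq_zero hν hb
      (cos_nonpos_of_pi_div_two_le_of_le h3 (by linarith [ht.1.2]))

theorem prod_uniformCircle_joint_tail {ν : Measure ℝ} [IsProbabilityMeasure ν]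
    (hν : ν (Set.Iic 0) = 0) {ψ b : ℝ} (hψ : 0 ≤ ψ) (hψ' : ψ < π) (hb : 0 < b) :
    ((ν.prod uniformCircle)
      {p | b < p.1 * p.2.1 ∧ b < p.1 * (cos ψ * p.2.1 + sin ψ * p.2.2)}).toReal =
      1 / π * ∫ φ in Set.Ioo (ψ / 2) (π / 2), (ν (Set.Ioi (b / cos φ))).toReal := by
  have hs : MeasurableSet {p : ℝ × (ℝ × ℝ) | b < p.1 * p.2.1 ∧
      b < p.1 * (cos ψ * p.2.1 + sin ψ * p.2.2)} := by
    rw [Set.ofPred_and]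
    exact (measurableSet_lt (by fun_prop) (by fun_prop)).inter
      (measurableSet_lt (by fun_prop) (by fun_prop))
  have hf := measurable_measure_prodMk_right (μ := ν) hs
  have hf' : Measurable fun t : ℝ => ν ((fun x => (x, (cos t, sin t))) ⁻¹'
      {p : ℝ × (ℝ × ℝ) | b < p.1 * p.2.1 ∧
        b < p.1 * (cos ψ * p.2.1 + sin ψ * p.2.2)}) := hf.comp (by fun_prop)
  rw [Measure.prod_apply_symm hs]
  unfold uniformCircle
  rw [lintegral_map hf (by fun_prop), lintegral_smul_measure, smul_eq_mul, ENNReal.toReal_mul,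
    ← integral_toReal hf'.aemeasurable
      (Eventually.of_forall fun _ => measure_lt_top _ _)]
  have h1 : ∫ t in Set.Ioc 0 (2 * π), (ν ((fun x => (x, (cos t, sin t))) ⁻¹'
      {p : ℝ × (ℝ × ℝ) | b < p.1 * p.2.1 ∧
        b < p.1 * (cos ψ * p.2.1 + sin ψ * p.2.2)})).toReal =
      ∫ t in (0)..(2 * π), radialMass ν ψ b t := by
    rw [intervalIntegral.integral_of_le (by positivity)]
    refine setIntegral_congr_fun measurableSet_Ioc fun t _ => ?_
    simp only [radialMass]
    rw [cos_sub, mul_comm (cos t), mul_comm (sin t)]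
    rfl
  rw [h1, integral_radialMass hν hψ hψ' hb, ENNReal.toReal_inv,
    ENNReal.toReal_ofReal (by positivity)]
  field_simp

theorem continuous_cdf_of_noAtoms (P : Measure ℝ) [IsProbabilityMeasure P]
    (hP : ∀ x, P {x} = 0) : Continuous (cdf P) := by
  rw [continuous_iff_continuousAt]
  intro x
  rw [(cdf P).mono.continuousAt_iff_leftLim_eq_rightLim, (cdf P).rightLim_eq]
  have h := (cdf P).measure_singleton x
  rw [measure_cdf, hP] at h
  have h1 := ENNReal.ofReal_eq_zero.1 h.symm
  exact le_antisymm ((cdf P).mono.leftLim_le le_rfl) (by linarith)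

/-- A law without atoms and with unbounded support admits an upper quantile function. -/
theorem exists_upper_quantile (P : Measure ℝ) [IsProbabilityMeasure P]
    (hP : ∀ x, P {x} = 0) (hpos : ∀ x, 0 < (P (Set.Ioi x)).toReal) :
    ∃ b : ℝ → ℝ, Tendsto b atTop atTop ∧ ∀ u > 1,
      (∀ t, 1 - 1 / u < (P (Set.Iic t)).toReal ↔ b u < t) ∧
      (P (Set.Ioi (b u))).toReal = 1 / u := by
  have hQ : ∀ t, (P (Set.Iic t)).toReal = cdf P t := fun t => (cdf_eq_real P t).symm
  have hcompl : ∀ t, (P (Set.Ioi t)).toReal = 1 - cdf P t := by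
    intro t
    have := probReal_compl_eq_one_sub (μ := P) (measurableSet_Iic (a := t))
    rw [Set.compl_Iic] at this
    rw [← hQ]
    exact this
  have hcont := continuous_cdf_of_noAtoms P hP
  have hmono := (cdf P).mono
  simp only [hQ, hcompl] at hpos ⊢
  have hbdd : ∀ u > 1, BddAbove {t | cdf P t ≤ 1 - 1 / u} := by
    intro u hu
    obtain ⟨M, hM⟩ := ((tendsto_cdf_atTop P).eventually_const_lt
      (show 1 - 1 / u < 1 by have : 0 < 1 / u := by positivity
                             linarith)).exists
    refine ⟨M, fun t ht => ?_⟩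
    by_contra h
    exact (hM.trans_le (hmono (not_le.1 h).le)).not_ge ht
  refine ⟨fun u => sSup {t | cdf P t ≤ 1 - 1 / u}, ?_, fun u hu => ?_⟩
  · rw [tendsto_atTop]
    intro M
    have h1 : Tendsto (fun u : ℝ => 1 / u) atTop (nhds 0) := by
      simpa using tendsto_inv_atTop_zero (𝕜 := ℝ)
    filter_upwards [h1.eventually_lt_const (hpos M), eventually_gt_atTop 1] with u hu hu1
    refine le_csSup (hbdd u hu1) ?_
    change cdf P M ≤ 1 - 1 / u
    linarith
  · set S := {t | cdf P t ≤ 1 - 1 / u} with hS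
    have hne : S.Nonempty := by
      have h1 : 0 < 1 - 1 / u := by
        have : 1 / u < 1 := by rw [div_lt_one (by linarith)]; exact hu
        linarith
      obtain ⟨t, ht⟩ := ((tendsto_cdf_atBot P).eventually_lt_const h1).exists
      exact ⟨t, ht.le⟩
    have hmem : cdf P (sSup S) ≤ 1 - 1 / u :=
      (isClosed_le hcont continuous_const).csSup_mem hne (hbdd u hu)
    have hgt : ∀ t, sSup S < t → 1 - 1 / u < cdf P t := by
      intro t ht
      by_contra h
      exact (le_csSup (hbdd u hu) (show t ∈ S from not_lt.1 h)).not_gt ht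
    refine ⟨fun t => ⟨fun h => ?_, hgt t⟩, ?_⟩
    · by_contra h'
      exact ((hmono (not_lt.1 h')).trans hmem).not_gt h
    · have h1 : 1 - 1 / u ≤ cdf P (sSup S) := by
        refine ge_of_tendsto ((hcont.tendsto (sSup S)).mono_left nhdsWithin_le_nhds)
          (f := cdf P) (b := 1 - 1 / u) (x := nhdsWithin (sSup S) (Set.Ioi (sSup S))) ?_
        filter_upwards [self_mem_nhdsWithin] with t ht using (hgt t ht).le
      linarith

theorem tendsto_neg_log_div_rpow {H : ℝ → ℝ} {K r θ N c : ℝ} (hK : 0 < K) (hθ : 0 < θ)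
    (hc : 0 < c)
    (hH : Tendsto (fun b => b ^ (θ / 2) * H b / kotzTail K r θ N b) atTop (nhds c)) :
    Tendsto (fun b => -log (H b) / b ^ θ) atTop (nhds r) := by
  have hlog : Tendsto (fun b : ℝ => log b / b ^ θ) atTop (nhds 0) :=
    (isLittleO_log_rpow_atTop hθ).tendsto_div_nhds_zero
  have hinv : Tendsto (fun b : ℝ => 1 / b ^ θ) atTop (nhds 0) :=
    tendsto_const_nhds.div_atTop (tendsto_rpow_atTop hθ)
  have h := ((hlog.const_mul (θ / 2 - N)).add (((hH.log hc.ne').add_const (log K)).neg.mul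
    hinv)).const_add r
  rw [mul_zero, mul_zero, add_zero, add_zero] at h
  refine h.congr' ?_
  filter_upwards [hH.eventually_const_lt hc, eventually_gt_atTop 0] with b hb hb0
  have hf := kotzTail_pos hK hb0 r θ N
  have hbp : 0 < b ^ (θ / 2) := by positivity
  have hHpos : 0 < H b := by
    have := (div_pos_iff_of_pos_right hf).1 hb
    exact (mul_pos_iff_of_pos_left hbp).1 this
  rw [log_div (by positivity) hf.ne', log_mul hbp.ne' hHpos.ne', log_rpow hb0]
  have hlf : log (kotzTail K r θ N b) = log K + N * log b - r * b ^ θ := by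
    unfold kotzTail
    rw [log_mul (by positivity) (exp_pos _).ne', log_mul hK.ne' (by positivity), log_rpow hb0,
      log_exp]
    ring
  rw [hlf]
  have : b ^ θ ≠ 0 := by positivity
  field_simp
  ring

theorem tendsto_div_neg_log_rpow_mul_rpow {H₁ H₂ : ℝ → ℝ} {K r θ N c₁ c₂ α : ℝ} (hK : 0 < K)
    (hr : 0 < r) (hθ : 0 < θ) (hc₁ : 0 < c₁) (hα : 0 < α)
    (h₁ : Tendsto (fun b => b ^ (θ / 2) * H₁ b / kotzTail K r θ N b) atTop (nhds c₁))
    (h₂ : Tendsto (fun b => (b * α) ^ θ * H₂ b / kotzTail K r θ N (b * α)) atTop (nhds c₂)) :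
    Tendsto (fun b => H₂ b / ((-log (H₁ b)) ^ ((1 - α ^ θ) * N / θ + α ^ θ / 2 - 1) *
        H₁ b ^ α ^ θ)) atTop
      (nhds (c₂ * (K ^ (1 - α ^ θ) * α ^ (N - θ)) /
        (r ^ ((1 - α ^ θ) * N / θ + α ^ θ / 2 - 1) * c₁ ^ α ^ θ))) := by
  set lam := α ^ θ with hlam
  set E := (1 - lam) * N / θ + lam / 2 - 1 with hE
  have hL := tendsto_neg_log_div_rpow hK hθ hc₁ h₁
  have hlim := (h₂.mul_const (K ^ (1 - lam) * α ^ (N - θ))).div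
    ((hL.rpow_const (p := E) (Or.inl hr.ne')).mul (h₁.rpow_const (p := lam) (Or.inl hc₁.ne')))
    (by positivity)
  refine hlim.congr' ?_
  filter_upwards [hL.eventually_const_lt hr, h₁.eventually_const_lt hc₁, eventually_gt_atTop 0]
    with b hLb hb hb0
  have hf := kotzTail_pos hK hb0 r θ N
  have hfα := kotzTail_pos hK (mul_pos hb0 hα) r θ N
  have hbp : 0 < b ^ (θ / 2) := by positivity
  have hbθ : 0 < b ^ θ := by positivity
  have hH₁ : 0 < H₁ b := by
    have := (div_pos_iff_of_pos_right hf).1 hb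
    exact (mul_pos_iff_of_pos_left hbp).1 this
  have hLpos : 0 < -log (H₁ b) := (div_pos_iff_of_pos_right hbθ).1 hLb
  simp only [Pi.div_apply]
  rw [div_rpow hLpos.le hbθ.le, div_rpow (by positivity) hf.le, mul_rpow hbp.le hH₁.le,
    mul_rpow hb0.le hα.le, ← hlam, ← rpow_mul hb0.le, ← rpow_mul hb0.le]
  have hflam : kotzTail K r θ N b ^ lam = K ^ lam * b ^ (N * lam) * exp (-r * b ^ θ * lam) := by
    unfold kotzTail
    rw [mul_rpow (by positivity) (exp_pos _).le, mul_rpow hK.le (by positivity),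
      ← rpow_mul hb0.le, ← exp_mul]
  have hfα' : kotzTail K r θ N (b * α) =
      K * (b ^ N * α ^ N) * exp (-r * b ^ θ * lam) := by
    unfold kotzTail
    rw [mul_rpow hb0.le hα.le, mul_rpow hb0.le hα.le, ← hlam, mul_assoc (-r)]
  have hKp : K ^ (1 - lam) = K / K ^ lam := by rw [rpow_sub hK, rpow_one]
  have hαp : α ^ (N - θ) = α ^ N / lam := by rw [rpow_sub hα]
  have hbpow : b ^ θ * b ^ (θ * E) * b ^ (N * lam) = b ^ N * b ^ (θ / 2 * lam) := by
    rw [← rpow_add hb0, ← rpow_add hb0, ← rpow_add hb0]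
    congr 1
    rw [hE]
    field_simp
    ring
  rw [hflam, hfα', hKp, hαp]
  have hl : 0 < lam := by positivity
  have e1 : 0 < exp (-r * b ^ θ * lam) := exp_pos _
  have e2 : 0 < (-log (H₁ b)) ^ E := by positivity
  have e3 : 0 < H₁ b ^ lam := by positivity
  have e4 : 0 < b ^ (θ * E) := by positivity
  have e5 : 0 < b ^ (N * lam) := by positivity
  have e6 : 0 < b ^ (θ / 2 * lam) := by positivity
  have e7 : 0 < b ^ N := by positivity
  have e8 : 0 < α ^ N := by positivity
  have e9 : 0 < K ^ lam := by positivity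
  generalize exp (-r * b ^ θ * lam) = x1 at *
  generalize (-log (H₁ b)) ^ E = x2 at *
  generalize H₁ b ^ lam = x3 at *
  generalize b ^ (θ * E) = x4 at *
  generalize b ^ (N * lam) = x5 at *
  generalize b ^ (θ / 2 * lam) = x6 at *
  generalize b ^ N = x7 at *
  generalize α ^ N = x8 at *
  generalize K ^ lam = x9 at *
  generalize b ^ θ = x10 at *
  field_simp
  linear_combination H₂ b * hbpow

theorem kotz_constant_eq {ρ K r θ N lam α a : ℝ} (hρ : ρ ∈ Set.Ioo (-1 : ℝ) 1) (hK : 0 < K)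
    (hr : 0 < r) (hθ : 0 < θ) (hα : α = √(2 / (1 + ρ)))
    (hta : tan a = √(1 - ρ) / √(1 + ρ)) :
    1 / π * (1 / (r * θ * tan a)) * (K ^ (1 - lam) * α ^ (N - θ)) /
        (r ^ ((1 - lam) * N / θ + lam / 2 - 1) * (1 / π * (√(π / (r * θ / 2)) / 2)) ^ lam) =
      α ^ (N - θ + 2) * (1 - ρ ^ 2) ^ ((3 : ℝ) / 2) * r ^ ((lam - 1) * N / θ) /
          (K * (1 - ρ) ^ 2) * (K ^ 2 / (2 * π * θ)) ^ (1 - lam / 2) := by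
  have hp : 0 < 1 + ρ := by linarith [hρ.1]
  have hq : 0 < 1 - ρ := by linarith [hρ.2]
  have hα0 : 0 < α := by rw [hα]; positivity
  have hD : 0 < 2 * π * θ := by positivity
  have h1 : (1 / π * (√(π / (r * θ / 2)) / 2)) ^ lam =
      (2 * π * θ) ^ (-(lam / 2)) * r ^ (-(lam / 2)) := by
    have : 1 / π * (√(π / (r * θ / 2)) / 2) = (2 * π * θ * r) ^ (-(1 / 2) : ℝ) := by
      rw [rpow_neg (by positivity), ← sqrt_eq_rpow, ← sqrt_inv,
        eq_comm, sqrt_eq_iff_mul_self_eq (by positivity) (by positivity)]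
      have h := mul_self_sqrt (show 0 ≤ π / (r * θ / 2) by positivity)
      rw [show ∀ x : ℝ, 1 / π * (x / 2) * (1 / π * (x / 2)) = x * x / (4 * π ^ 2) from
        fun x => by field_simp; norm_num, h]
      field_simp
      norm_num
    rw [this, ← rpow_mul (by positivity), mul_rpow hD.le hr.le]
    ring_nf
  have h2 : K ^ (1 - lam) = K ^ (2 - lam) / K := by
    rw [show 1 - lam = 2 - lam - 1 by ring, rpow_sub hK, rpow_one]
  have h3 : (K ^ 2 / (2 * π * θ)) ^ (1 - lam / 2) =
      K ^ (2 - lam) / (2 * π * θ * (2 * π * θ) ^ (-(lam / 2))) := by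
    rw [div_rpow (by positivity) hD.le, ← rpow_natCast K 2, ← rpow_mul hK.le,
      sub_eq_add_neg 1 (lam / 2), rpow_add hD, rpow_one]
    congr 2
    push_cast
    ring
  have h4 : r ^ ((lam - 1) * N / θ) *
      (r ^ ((1 - lam) * N / θ + lam / 2 - 1) * r ^ (-(lam / 2)) * r) = 1 := by
    rw [← rpow_add hr, ← rpow_add_one hr.ne', ← rpow_add hr, ← rpow_zero r]
    congr 1
    ring
  have h5 : α ^ (N - θ + 2) = α ^ (N - θ) * (2 / (1 + ρ)) := by
    rw [rpow_add hα0, rpow_two, hα, sq_sqrt (by positivity)]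
  have h6 : (1 - ρ ^ 2) ^ ((3 : ℝ) / 2) = (√(1 + ρ) * √(1 - ρ)) ^ 3 := by
    rw [← sqrt_mul hp.le, show (1 + ρ) * (1 - ρ) = 1 - ρ ^ 2 by ring, sqrt_eq_rpow,
      ← rpow_natCast (_ ^ _ : ℝ) 3,
      ← rpow_mul (by nlinarith)]
    norm_num
  rw [h1, h2, h3, h5, h6, hta]
  have hps := sq_sqrt hp.le
  have hqs := sq_sqrt hq.le
  have p0 : 0 < √(1 + ρ) := sqrt_pos.2 hp
  have q0 : 0 < √(1 - ρ) := sqrt_pos.2 hq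
  generalize √(1 + ρ) = p at *
  generalize √(1 - ρ) = q at *
  rw [← hps, ← hqs]
  have e1 : 0 < r ^ ((1 - lam) * N / θ + lam / 2 - 1) := by positivity
  have e2 : 0 < r ^ (-(lam / 2)) := by positivity
  have e3 : 0 < (2 * π * θ) ^ (-(lam / 2)) := by positivity
  generalize r ^ ((1 - lam) * N / θ + lam / 2 - 1) = x1 at *
  generalize r ^ (-(lam / 2)) = x2 at *
  generalize (2 * π * θ) ^ (-(lam / 2)) = x3 at *
  generalize r ^ ((lam - 1) * N / θ) = x4 at *
  generalize α ^ (N - θ) = x5 at *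
  generalize K ^ (2 - lam) = x6 at *
  have : x4 = 1 / (x1 * x2 * r) := by rw [eq_div_iff (by positivity)]; exact h4
  rw [this]
  field_simp

/-- Example 3 (Kotz Type III): if `P(R > u) = (1+o(1)) K u^N exp(-r u^θ)` as `u → ∞`
(`K, r, θ > 0`, `N ∈ ℝ`), then with `λ = α_ρ^θ`, as `u → ∞`,
`S̃_u(1,1) = (1+o(1)) [α_ρ^(N-θ+2)(1-ρ²)^(3/2) r^((λ-1)N/θ) / (K(1-ρ)²)]
  (K²/(2πθ))^(1-λ/2) (ln u)^((1-λ)N/θ+λ/2-1) u^(-λ)`. -/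
theorem kotz_joint_survival_asymptotics
    {Ω : Type*} [MeasurableSpace Ω] (μ : Measure Ω) [IsProbabilityMeasure μ]
    (R U₁ U₂ : Ω → ℝ) (ρ : ℝ) (hρ : ρ ∈ Set.Ioo (-1 : ℝ) 1)
    (hRmeas : Measurable R) (hUmeas : Measurable fun ω => (U₁ ω, U₂ ω))
    (hIndep : IndepFun R (fun ω => (U₁ ω, U₂ ω)) μ)
    (hUnif : Measure.map (fun ω => (U₁ ω, U₂ ω)) μ = uniformCircle)
    (X₁ X₂ : Ω → ℝ)
    (hX₁ : X₁ = fun ω => R ω * U₁ ω)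
    (hX₂ : X₂ = fun ω => R ω * (ρ * U₁ ω + Real.sqrt (1 - ρ ^ 2) * U₂ ω))
    -- `F` is the distribution function of the positive random radius `R`
    (F : ℝ → ℝ) (hF : F = fun t => (μ {ω | R ω ≤ t}).toReal)
    (hF0 : F 0 = 0) (hFlt : ∀ x > (0 : ℝ), F x < 1)
    -- `Q` is the distribution function of `X₁`
    (Q : ℝ → ℝ) (hQ : Q = fun t => (μ {ω | X₁ ω ≤ t}).toReal)
    -- Kotz Type III tail: `P(R > u) = (1+o(1)) K u^N exp(-r u^θ)` as `u → ∞`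
    (K r θ : ℝ) (hK : 0 < K) (hr : 0 < r) (hθ : 0 < θ) (N : ℝ)
    (hKotz : Tendsto
      (fun u => (μ {ω | u < R ω}).toReal / (K * u ^ N * Real.exp (-r * u ^ θ)))
      atTop (nhds 1))
    -- the joint survival function `S̃_u(x,y)`
    (Stilde : ℝ → ℝ → ℝ → ℝ)
    (hStilde : ∀ u x y,
      Stilde u x y = (μ {ω | 1 - x / u < Q (X₁ ω) ∧ 1 - y / u < Q (X₂ ω)}).toReal)
    (αρ : ℝ) (hαρ : αρ = Real.sqrt (2 / (1 + ρ)))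
    (lam : ℝ) (hlam : lam = αρ ^ θ) :
    Tendsto
      (fun u => Stilde u 1 1 /
        (αρ ^ (N - θ + 2) * (1 - ρ ^ 2) ^ ((3 : ℝ) / 2) * r ^ ((lam - 1) * N / θ) /
            (K * (1 - ρ) ^ 2) *
          (K ^ 2 / (2 * Real.pi * θ)) ^ (1 - lam / 2) *
          Real.log u ^ ((1 - lam) * N / θ + lam / 2 - 1) * u ^ (-lam)))
      atTop (nhds 1) := by
  obtain ⟨hρ1, hρ2⟩ := hρ
  have hp : 0 < 1 + ρ := by linarith
  have hq : 0 < 1 - ρ := by linarith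
  set ψ := arccos ρ with hψdef
  have hcosψ : cos ψ = ρ := cos_arccos hρ1.le hρ2.le
  have hsinψ : sin ψ = √(1 - ρ ^ 2) := sin_arccos ρ
  have hψ0 : 0 < ψ := arccos_pos.2 hρ2
  have hψπ : ψ < π := (arccos_lt_pi).2 hρ1
  have hαpos : 0 < αρ := by rw [hαρ]; positivity
  have hcos_half : cos (ψ / 2) = αρ⁻¹ := by
    rw [cos_half (by linarith [pi_pos]) hψπ.le, hcosψ, hαρ, ← sqrt_inv, inv_div]
  have htan_half : tan (ψ / 2) = √(1 - ρ) / √(1 + ρ) := by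
    rw [tan_eq_sin_div_cos, cos_half (by linarith [pi_pos]) hψπ.le,
      sin_half_eq_sqrt hψ0.le (by linarith), hcosψ, ← sqrt_div (by positivity),
      ← sqrt_div (by positivity)]
    congr 1
    field_simp
  have htan_pos : 0 < tan (ψ / 2) := by rw [htan_half]; positivity
  set ν := Measure.map R μ with hνdef
  have : IsProbabilityMeasure ν := Measure.isProbabilityMeasure_map hRmeas.aemeasurable
  have hν : ν (Set.Iic 0) = 0 := by
    rw [hνdef, Measure.map_apply hRmeas measurableSet_Iic]
    rw [hF] at hF0
    exact ((ENNReal.toReal_eq_zero_iff _).1 hF0).resolve_right (measure_ne_top _ _)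
  have hlaw : Measure.map (fun ω => (R ω, (U₁ ω, U₂ ω))) μ = ν.prod uniformCircle := by
    rw [← hUnif]
    exact (indepFun_iff_map_prod_eq_prod_map_map hRmeas.aemeasurable
      hUmeas.aemeasurable).1 hIndep
  have hpairmeas : Measurable fun ω => (R ω, (U₁ ω, U₂ ω)) := hRmeas.prodMk hUmeas
  have hX₁meas : Measurable X₁ := by
    rw [hX₁]; exact hRmeas.mul hUmeas.fst
  set P := Measure.map X₁ μ with hPdef
  have : IsProbabilityMeasure P := Measure.isProbabilityMeasure_map hX₁meas.aemeasurable
  set G : ℝ → ℝ := fun x => (ν (Set.Ioi x)).toReal with hGdef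
  have hGanti : Antitone G := fun x y hxy =>
    measureReal_mono (μ := ν) (Set.Ioi_subset_Ioi hxy)
  have hG0 : ∀ x, 0 ≤ G x := fun x => ENNReal.toReal_nonneg
  have hG : Tendsto (fun u => G u / kotzTail K r θ N u) atTop (nhds 1) := by
    refine hKotz.congr fun u => ?_
    simp only [hGdef, hνdef, Measure.map_apply hRmeas measurableSet_Ioi]
    rfl
  have hmeas_joint : ∀ c d b : ℝ, MeasurableSet {p : ℝ × (ℝ × ℝ) | b < p.1 * p.2.1 ∧
      b < p.1 * (c * p.2.1 + d * p.2.2)} := fun c d b => by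
    rw [Set.ofPred_and]
    exact (measurableSet_lt (by fun_prop) (by fun_prop)).inter
      (measurableSet_lt (by fun_prop) (by fun_prop))
  have htail₁ : ∀ b > 0, (P (Set.Ioi b)).toReal =
      1 / π * ∫ φ in Set.Ioo 0 (π / 2), G (b / cos φ) := by
    intro b hb
    have h := prod_uniformCircle_joint_tail hν le_rfl pi_pos hb
    rw [zero_div] at h
    rw [← h, ← hlaw, Measure.map_apply hpairmeas (hmeas_joint _ _ _), hPdef,
      Measure.map_apply hX₁meas measurableSet_Ioi, hX₁]
    congr 2
    ext ω
    simp
  have htail₂ : ∀ b > 0, (μ {ω | b < X₁ ω ∧ b < X₂ ω}).toReal =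
      1 / π * ∫ φ in Set.Ioo (ψ / 2) (π / 2), G (b / cos φ) := by
    intro b hb
    rw [← prod_uniformCircle_joint_tail hν hψ0.le hψπ hb, ← hlaw,
      Measure.map_apply hpairmeas (hmeas_joint _ _ _), hX₁, hX₂, hcosψ, hsinψ]
    rfl
  have hasymp₁ : Tendsto (fun b => b ^ (θ / 2) * (P (Set.Ioi b)).toReal / kotzTail K r θ N b)
      atTop (nhds (1 / π * (√(π / (r * θ / 2)) / 2))) := by
    refine ((tendsto_laplace_zero hGanti hG0 hK hr hθ hG).const_mul (1 / π)).congr' ?_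
    filter_upwards [eventually_gt_atTop 0] with b hb
    rw [htail₁ b hb]
    ring
  have hasymp₂ : Tendsto (fun b => (b * αρ) ^ θ * (μ {ω | b < X₁ ω ∧ b < X₂ ω}).toReal /
      kotzTail K r θ N (b * αρ)) atTop (nhds (1 / π * (1 / (r * θ * tan (ψ / 2))))) := by
    refine ((tendsto_laplace_pos hGanti hG0 hK hr hθ hG (half_pos hψ0)
      (by linarith)).const_mul (1 / π)).congr' ?_
    filter_upwards [eventually_gt_atTop 0] with b hb
    rw [htail₂ b hb, hcos_half, div_inv_eq_mul]
    ring
  have hc₁ : 0 < 1 / π * (√(π / (r * θ / 2)) / 2) := by positivity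
  have hPpos : ∀ x, 0 < (P (Set.Ioi x)).toReal := by
    intro x
    obtain ⟨b, hb, hbx, hb0⟩ := ((hasymp₁.eventually_const_lt hc₁).and
      ((eventually_ge_atTop x).and (eventually_gt_atTop 0))).exists
    have hf := kotzTail_pos hK hb0 r θ N
    have h1 := (mul_pos_iff_of_pos_left (show 0 < b ^ (θ / 2) by positivity)).1
      ((div_pos_iff_of_pos_right hf).1 hb)
    exact h1.trans_le (measureReal_mono (μ := P) (Set.Ioi_subset_Ioi hbx))
  have hPatom : ∀ x, P {x} = 0 := by
    intro x
    have h := prod_uniformCircle_setOf_mul_eq hν x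
    rw [← hlaw, Measure.map_apply hpairmeas
      (measurableSet_eq_fun (by fun_prop) (by fun_prop))] at h
    rw [hPdef, Measure.map_apply hX₁meas (measurableSet_singleton x), hX₁]
    exact h
  have hQP : ∀ t, Q t = (P (Set.Iic t)).toReal := by
    intro t
    rw [hQ, hPdef, Measure.map_apply hX₁meas measurableSet_Iic]
    rfl
  obtain ⟨b, hbtop, hb⟩ := exists_upper_quantile P hPatom hPpos
  have hratio := (tendsto_div_neg_log_rpow_mul_rpow hK hr hθ hc₁ hαpos hasymp₁ hasymp₂).comp hbtop
  rw [← hlam, kotz_constant_eq ⟨hρ1, hρ2⟩ hK hr hθ hαρ htan_half] at hratio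
  set C := αρ ^ (N - θ + 2) * (1 - ρ ^ 2) ^ ((3 : ℝ) / 2) * r ^ ((lam - 1) * N / θ) /
    (K * (1 - ρ) ^ 2) * (K ^ 2 / (2 * π * θ)) ^ (1 - lam / 2)
  have hC : 0 < C := by
    have : 0 < 1 - ρ ^ 2 := by nlinarith
    positivity
  have hfin := hratio.div_const C
  rw [div_self hC.ne'] at hfin
  refine hfin.congr' ?_
  filter_upwards [eventually_gt_atTop 1] with u hu
  obtain ⟨hset, htail⟩ := hb u hu
  have hu0 : 0 < u := by linarith
  have hS : Stilde u 1 1 = (μ {ω | b u < X₁ ω ∧ b u < X₂ ω}).toReal := by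
    rw [hStilde]
    simp only [hQP, hset]
  simp only [Function.comp]
  rw [hS, htail, one_div, log_inv, neg_neg, inv_rpow hu0.le, rpow_neg hu0.le, div_div]
  congr 1
  ring
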